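/- arXiv:math/0004187 — 2 statements merged into one kernel-verified Lean document; each statement's English description precedes it below -/
import Mathlib

section
/- (Gauss) For every natural number m, the alternating sum of q-binomial coefficients of odd order vanishes: Σ_{ℓ=0}^{2m+1} [2m+1,ℓ]_q · (−1)^ℓ = 0. -/
/-- The Gaussian (`q`-binomial) coefficient `[n, k]_q`, defined by the recurrence
`[n, 0]_q = 1`, `[0, k+1]_q = 0`, `[n+1, k+1]_q = [n, k]_q + q^(k+1) * [n, k+1]_q`
(so that `[n+1, k]_q = [n, k-1]_q + q^k * [n, k]_q` and `[n, k]_q = 0` for `k > n`). -/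
def qBinom {R : Type*} [CommRing R] (q : R) : ℕ → ℕ → R
  | _, 0 => 1
  | 0, _ + 1 => 0
  | n + 1, k + 1 => qBinom q n k + q ^ (k + 1) * qBinom q n (k + 1)

theorem qBinom_zero_right {R : Type*} [CommRing R] (q : R) (n : ℕ) : qBinom q n 0 = 1 := by
  cases n <;> rfl

theorem qBinom_succ_succ {R : Type*} [CommRing R] (q : R) (n k : ℕ) :
    qBinom q (n + 1) (k + 1) = qBinom q n k + q ^ (k + 1) * qBinom q n (k + 1) := rfl

theorem qBinom_eq_zero_of_lt {R : Type*} [CommRing R] (q : R) {n k : ℕ} (h : n < k) :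
    qBinom q n k = 0 := by
  induction n generalizing k with
  | zero =>
    obtain ⟨k, rfl⟩ := Nat.exists_eq_succ_of_ne_zero h.ne'
    rfl
  | succ n ih =>
    obtain ⟨k, rfl⟩ := Nat.exists_eq_succ_of_ne_zero (Nat.ne_zero_of_lt h)
    rw [Nat.succ_eq_add_one, qBinom_succ_succ, ih (by lia), ih (by lia)]
    ring

theorem qBinom_self {R : Type*} [CommRing R] (q : R) (n : ℕ) : qBinom q n n = 1 := by
  induction n with
  | zero => rfl
  | succ n ih => rw [qBinom_succ_succ, ih, qBinom_eq_zero_of_lt q n.lt_succ_self]; ring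

/-- The second Pascal recurrence for Gaussian coefficients. -/
theorem qBinom_succ_succ' {R : Type*} [CommRing R] (q : R) {n k : ℕ} (h : k ≤ n) :
    qBinom q (n + 1) (k + 1) = q ^ (n - k) * qBinom q n k + qBinom q n (k + 1) := by
  induction n generalizing k with
  | zero =>
    obtain rfl : k = 0 := by lia
    simp [qBinom]
  | succ n ih =>
    cases k with
    | zero =>
      have h₁ := ih (Nat.zero_le n)
      have h₂ := qBinom_succ_succ q n 0
      have h₃ := qBinom_succ_succ q (n + 1) 0
      simp only [qBinom_zero_right, Nat.sub_zero, zero_add, pow_one, mul_one] at *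
      rw [pow_succ]
      linear_combination h₃ + q * h₁ - h₂
    | succ k =>
      rcases (Nat.le_of_succ_le_succ h).eq_or_lt with rfl | hk
      · rw [qBinom_self, qBinom_self, qBinom_eq_zero_of_lt q (Nat.lt_succ_self _)]
        simp
      · obtain ⟨d, rfl⟩ := Nat.exists_eq_add_of_lt hk
        have h₁ := ih (k := k) (by lia)
        have h₂ := ih (k := k + 1) (by lia)
        have h₃ := qBinom_succ_succ q (k + d + 1) k
        have h₄ := qBinom_succ_succ q (k + d + 1) (k + 1)
        have h₅ := qBinom_succ_succ q (k + d + 1 + 1) (k + 1)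
        rw [show k + d + 1 - k = d + 1 by lia] at h₁
        rw [show k + d + 1 - (k + 1) = d by lia] at h₂
        rw [show k + d + 1 + 1 - (k + 1) = d + 1 by lia]
        linear_combination h₅ + h₁ + q ^ (k + 2) * h₂ - q ^ (d + 1) * h₃ - h₄

theorem qBinom_symm_add {R : Type*} [CommRing R] (q : R) (a b : ℕ) :
    qBinom q (a + b) a = qBinom q (a + b) b := by
  induction hn : a + b generalizing a b with
  | zero =>
    obtain ⟨rfl, rfl⟩ : a = 0 ∧ b = 0 := by lia
    rfl
  | succ n ih =>
    cases a with
    | zero => rw [← hn, zero_add, qBinom_self, qBinom_zero_right]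
    | succ a =>
      cases b with
      | zero => rw [← hn, add_zero, qBinom_self, qBinom_zero_right]
      | succ b =>
        rw [qBinom_succ_succ, qBinom_succ_succ' q (show b ≤ n by lia),
          ih a (b + 1) (by lia), ih (a + 1) b (by lia), show n - b = a + 1 by lia]
        ring

/-- Gauss: the alternating sum of `q`-binomial coefficients of odd order vanishes. -/
theorem gauss_alternating_sum_odd {R : Type*} [CommRing R] (q : R) (m : ℕ) :
    ∑ ℓ ∈ Finset.range (2 * m + 1 + 1), qBinom q (2 * m + 1) ℓ * (-1) ^ ℓ = 0 := by
  rw [show 2 * m + 1 + 1 = (m + 1) + (m + 1) by ring, Finset.sum_range_add,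
    ← Finset.sum_range_reflect (fun i => qBinom q (2 * m + 1) (m + 1 + i) * (-1) ^ (m + 1 + i)),
    ← Finset.sum_add_distrib]
  refine Finset.sum_eq_zero fun i hi => ?_
  rw [Finset.mem_range] at hi
  obtain ⟨j, hj⟩ : ∃ j, 2 * m + 1 = i + j := ⟨2 * m + 1 - i, by lia⟩
  have hsign : (-1 : R) ^ i * (-1) ^ j = -1 := by
    rw [← pow_add, ← hj]
    exact Odd.neg_one_pow ⟨m, rfl⟩
  have hsq : (-1 : R) ^ i * (-1) ^ i = 1 := by
    rw [← mul_pow]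
    simp
  rw [show m + 1 + (m + 1 - 1 - i) = j by lia, hj, qBinom_symm_add]
  linear_combination qBinom q (i + j) j * (-1) ^ i * hsign - qBinom q (i + j) j * (-1) ^ j * hsq
end

section
/- For every natural number N: Σ_{ℓ=0}^{N} [N,ℓ]_{q²} · q^ℓ = ∏_{k=1}^{N} (1 + q^k). -/
/-- The Rogers–Szegő polynomial `∑_{k=0}^{n} [n, k]_q x^k`. -/
def rogersSzego {R : Type*} [CommRing R] (q : R) (n : ℕ) (x : R) : R :=
  ∑ k ∈ Finset.range (n + 1), qBinom q n k * x ^ k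

theorem rogersSzego_zero {R : Type*} [CommRing R] (q x : R) : rogersSzego q 0 x = 1 := by
  simp [rogersSzego, qBinom_zero_right]

theorem rogersSzego_succ {R : Type*} [CommRing R] (q : R) (n : ℕ) (x : R) :
    rogersSzego q (n + 1) x = x * rogersSzego q n x + rogersSzego q n (q * x) := by
  have h : rogersSzego q n (q * x) =
      ∑ k ∈ Finset.range (n + 1), qBinom q n (k + 1) * (q * x) ^ (k + 1) + 1 := by
    rw [Finset.sum_range_succ, qBinom_eq_zero_of_lt q n.lt_succ_self, zero_mul, add_zero,
      rogersSzego, Finset.sum_range_succ', qBinom_zero_right, pow_zero, mul_one]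
  rw [h, rogersSzego, Finset.sum_range_succ', qBinom_zero_right, pow_zero, mul_one, rogersSzego,
    Finset.mul_sum, ← add_assoc, ← Finset.sum_add_distrib]
  congr 1
  refine Finset.sum_congr rfl fun k _ => ?_
  rw [qBinom_succ_succ]
  ring

/-- The `q`-difference equation of the Rogers–Szegő polynomials. -/
theorem rogersSzego_succ_mul {R : Type*} [CommRing R] (q : R) (n : ℕ) (x : R) :
    rogersSzego q (n + 1) (q * x) =
      rogersSzego q (n + 1) x - x * (1 - q ^ (n + 1)) * rogersSzego q n x := by
  induction n generalizing x with
  | zero =>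
    simp only [rogersSzego_succ, rogersSzego_zero]
    ring
  | succ n ih =>
    linear_combination rogersSzego_succ q (n + 1) (q * x) - rogersSzego_succ q (n + 1) x +
      ih (q * x) + q * x * ih x + q * x * (1 - q ^ (n + 1)) * rogersSzego_succ q n x

/-- The three-term recurrence of the Rogers–Szegő polynomials. -/
theorem rogersSzego_succ_succ {R : Type*} [CommRing R] (q : R) (n : ℕ) (x : R) :
    rogersSzego q (n + 2) x =
      (1 + x) * rogersSzego q (n + 1) x - x * (1 - q ^ (n + 1)) * rogersSzego q n x := by
  rw [rogersSzego_succ, rogersSzego_succ_mul]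
  ring

theorem rogersSzego_sq_succ {R : Type*} [CommRing R] (q : R) (n : ℕ) :
    rogersSzego (q ^ 2) (n + 1) q = (1 + q ^ (n + 1)) * rogersSzego (q ^ 2) n q := by
  induction n with
  | zero =>
    simp only [rogersSzego_succ, rogersSzego_zero]
    ring
  | succ n ih =>
    rw [rogersSzego_succ_succ, ih]
    ring

/-- Formula (5.5): `∑_{ℓ=0}^{N} [N,ℓ]_{q²} q^ℓ = (1+q)(1+q²)⋯(1+q^N)`. -/
theorem qBinom_sq_sum {R : Type*} [CommRing R] (q : R) (N : ℕ) :
    ∑ ℓ ∈ Finset.range (N + 1), qBinom (q ^ 2) N ℓ * q ^ ℓ =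
      ∏ k ∈ Finset.range N, (1 + q ^ (k + 1)) := by
  change rogersSzego (q ^ 2) N q = _
  induction N with
  | zero => rw [rogersSzego_zero, Finset.prod_range_zero]
  | succ N ih => rw [rogersSzego_sq_succ, ih, Finset.prod_range_succ, mul_comm]
end
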